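/- arXiv:1712.10330 — 2 statements merged into one kernel-verified Lean document; each statement's English description precedes it below -/
import Mathlib

section
/- Let 0 < α < 1. Then E_α(-t^α) is asymptotically equivalent to t^{-α} / Γ(1 - α) as t → ∞; that is, the ratio E_α(-t^α) / (t^{-α} / Γ(1-α)) tends to 1 as t → ∞. -/
open Filter

/-- The one-parameter Mittag-Leffler function `E_α(x) = ∑ xⁿ / Γ(αn + 1)`. -/
noncomputable def mittagLeffler (α x : ℝ) : ℝ :=
  ∑' n : ℕ, x ^ n / Real.Gamma (α * n + 1)

open MeasureTheory Set Topology

lemma Real.Gamma_div_Gamma_add_le {α y : ℝ} (hα0 : 0 < α) (hα1 : α < 1) (hy : α ≤ y) :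
    Real.Gamma y / Real.Gamma (y + α) ≤ 2 * (y + α) ^ (-α) := by
  have hy0 : 0 < y := hα0.trans_le hy
  have hs : 0 < y + α := by positivity
  have hG := Real.Gamma_pos_of_pos hs
  have h := Real.Gamma_mul_add_mul_le_rpow_Gamma_mul_rpow_Gamma hs (add_pos hs one_pos) hα0
    (sub_pos.2 hα1) (by ring)
  rw [show α * (y + α) + (1 - α) * (y + α + 1) = y + 1 by ring, Real.Gamma_add_one hy0.ne',
    Real.Gamma_add_one hs.ne', Real.mul_rpow hs.le hG.le, mul_left_comm, ← Real.rpow_add hG,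
    show α + (1 - α) = 1 by ring, Real.rpow_one, sub_eq_add_neg, Real.rpow_add hs,
    Real.rpow_one] at h
  rw [div_le_iff₀ hG]
  refine le_of_mul_le_mul_left (h.trans ?_) hy0
  have : 0 ≤ (y + α) ^ (-α) * Real.Gamma (y + α) := by positivity
  nlinarith

lemma summable_pow_div_Gamma {α γ : ℝ} (hα0 : 0 < α) (hα1 : α < 1) (hγ : 0 < γ) (x : ℝ) :
    Summable fun n : ℕ => x ^ n / Real.Gamma (α * n + γ) := by
  rcases eq_or_ne x 0 with rfl | hx
  · exact summable_of_ne_finset_zero (s := {0}) fun n hn => by simp_all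
  have hpos (n : ℕ) : 0 < Real.Gamma (α * n + γ) := Real.Gamma_pos_of_pos (by positivity)
  refine summable_of_ratio_test_tendsto_lt_one zero_lt_one
    (Eventually.of_forall fun n => div_ne_zero (pow_ne_zero n hx) (hpos n).ne') ?_
  have hlin : Tendsto (fun n : ℕ => α * n + γ) atTop atTop :=
    tendsto_atTop_add_const_right _ _ (tendsto_natCast_atTop_atTop.const_mul_atTop hα0)
  have hlim : Tendsto (fun n : ℕ => |x| * (2 * (α * n + γ + α) ^ (-α))) atTop (𝓝 0) := by
    simpa using (((tendsto_rpow_neg_atTop hα0).comp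
      (tendsto_atTop_add_const_right _ α hlin)).const_mul 2).const_mul |x|
  refine tendsto_of_tendsto_of_tendsto_of_le_of_le' tendsto_const_nhds hlim
    (Eventually.of_forall fun n => by positivity) ?_
  filter_upwards [hlin.eventually_ge_atTop α] with n hn
  have h := Real.Gamma_div_Gamma_add_le hα0 hα1 hn
  have h1 : α * ((n + 1 : ℕ) : ℝ) + γ = α * n + γ + α := by push_cast; ring
  have h2 : 0 < Real.Gamma (α * n + γ + α) := h1 ▸ hpos (n + 1)
  calc _ = |x| * (Real.Gamma (α * n + γ) / Real.Gamma (α * n + γ + α)) := by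
        rw [h1, norm_div, norm_div, norm_pow, norm_pow, Real.norm_of_nonneg (hpos n).le,
          Real.norm_of_nonneg h2.le, Real.norm_eq_abs, pow_succ]
        have := (hpos n).ne'
        have := abs_ne_zero.2 hx
        field_simp
    _ ≤ _ := by gcongr

/-- The function `t ^ (γ - 1) * E_{α,γ}(-t ^ α)`, where `E_{α,γ}` is the two-parameter
Mittag-Leffler function. -/
noncomputable def mittagLefflerRelaxation (α γ t : ℝ) : ℝ :=
  t ^ (γ - 1) * ∑' n : ℕ, (-(t ^ α)) ^ n / Real.Gamma (α * n + γ)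

section Relaxation

variable {α γ : ℝ}

lemma continuous_tsum_neg_pow_div_Gamma (hα0 : 0 < α) (hα1 : α < 1) (hγ : 0 < γ) :
    Continuous fun x : ℝ => ∑' n : ℕ, (-x) ^ n / Real.Gamma (α * n + γ) := by
  refine continuous_iff_continuousAt.2 fun x => ?_
  have hc : ContinuousOn (fun x : ℝ => ∑' n : ℕ, (-x) ^ n / Real.Gamma (α * n + γ))
      (Metric.ball 0 (|x| + 1)) := by
    refine continuousOn_tsum (fun n => by fun_prop)
      (summable_pow_div_Gamma hα0 hα1 hγ (|x| + 1)) fun n y hy => ?_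
    have hG : 0 < Real.Gamma (α * n + γ) := Real.Gamma_pos_of_pos (by positivity)
    rw [norm_div, Real.norm_of_nonneg hG.le, norm_pow, norm_neg]
    gcongr
    simpa using (mem_ball_zero_iff.1 hy).le
  exact hc.continuousAt (Metric.isOpen_ball.mem_nhds (by simp))

lemma hasSum_mittagLefflerRelaxation (hα0 : 0 < α) (hα1 : α < 1) (hγ : 0 < γ) {t : ℝ}
    (ht : 0 < t) :
    HasSum (fun n : ℕ => (-1) ^ n * t ^ (α * n + γ - 1) / Real.Gamma (α * n + γ))
      (mittagLefflerRelaxation α γ t) := by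
  refine ((summable_pow_div_Gamma hα0 hα1 hγ (-(t ^ α))).hasSum.mul_left (t ^ (γ - 1))).congr_fun
    fun n => ?_
  rw [neg_pow (t ^ α), ← Real.rpow_mul_natCast ht.le, add_sub_assoc, Real.rpow_add ht]
  ring

lemma continuousOn_mittagLefflerRelaxation (hα0 : 0 < α) (hα1 : α < 1) (hγ : 0 < γ) :
    ContinuousOn (mittagLefflerRelaxation α γ) (Ioi 0) := by
  refine ContinuousOn.mul ?_ ?_
  · exact fun t ht => (Real.continuousAt_rpow_const _ _ (.inl (ne_of_gt ht))).continuousWithinAt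
  · exact ((continuous_tsum_neg_pow_div_Gamma hα0 hα1 hγ).comp
      (Real.continuous_rpow_const hα0.le)).continuousOn

lemma mittagLefflerRelaxation_one (t : ℝ) :
    mittagLefflerRelaxation α 1 t = mittagLeffler α (-(t ^ α)) := by
  simp [mittagLefflerRelaxation, mittagLeffler]

lemma mittagLefflerRelaxation_add (hα0 : 0 < α) (hα1 : α < 1) (hγ : 0 < γ) {t : ℝ}
    (ht : 0 < t) :
    mittagLefflerRelaxation α γ t + mittagLefflerRelaxation α (γ + α) t =
      t ^ (γ - 1) / Real.Gamma γ := by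
  have h := hasSum_mittagLefflerRelaxation hα0 hα1 hγ ht
  have h' := (hasSum_mittagLefflerRelaxation hα0 hα1 (add_pos hγ hα0) ht).neg
  rw [← hasSum_nat_add_iff' 1] at h
  have h2 := h.unique (by
    convert h' using 2 with n
    rw [pow_succ]
    push_cast
    rw [show α * ((n : ℝ) + 1) + γ = α * n + (γ + α) by ring]
    ring)
  simp at h2
  linarith

lemma eventually_mittagLefflerRelaxation_pos (hα0 : 0 < α) (hα1 : α < 1) (hγ : 0 < γ) :
    ∀ᶠ t in 𝓝[>] 0, 0 < mittagLefflerRelaxation α γ t := by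
  have hc := ((continuous_tsum_neg_pow_div_Gamma hα0 hα1 hγ).comp
    (Real.continuous_rpow_const hα0.le)).tendsto 0
  have h0 : ∑' n : ℕ, (-((0 : ℝ) ^ α)) ^ n / Real.Gamma (α * n + γ) = 1 / Real.Gamma γ := by
    rw [tsum_eq_single 0 fun n hn => by simp [Real.zero_rpow hα0.ne', hn]]
    simp
  rw [Function.comp_apply, h0] at hc
  have hG : 0 < 1 / Real.Gamma γ := by have := Real.Gamma_pos_of_pos hγ; positivity
  filter_upwards [nhdsWithin_le_nhds (hc.eventually_const_lt hG), self_mem_nhdsWithin]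
    with t ht ht0
  exact mul_pos (Real.rpow_pos_of_pos ht0 _) ht

end Relaxation

lemma integral_sub_rpow_mul_rpow {p q t : ℝ} (hp : 0 < p) (hq : 0 < q) (ht : 0 < t) :
    ∫ s in 0..t, (t - s) ^ (p - 1) * s ^ (q - 1) =
      t ^ (q + p - 1) * (Real.Gamma p * Real.Gamma q / Real.Gamma (q + p)) := by
  have h := Complex.betaIntegral_scaled q p ht
  rw [Complex.betaIntegral_eq_Gamma_mul_div _ _ (by simpa) (by simpa)] at h
  rw [← Complex.ofReal_inj, ← intervalIntegral.integral_ofReal]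
  convert h using 1
  · refine intervalIntegral.integral_congr fun s hs => ?_
    rw [uIcc_of_le ht.le] at hs
    rw [Complex.ofReal_mul, Complex.ofReal_cpow (sub_nonneg.2 hs.2), Complex.ofReal_cpow hs.1]
    push_cast
    ring
  · rw [← Complex.ofReal_add, Complex.Gamma_ofReal, Complex.Gamma_ofReal, Complex.Gamma_ofReal,
      Complex.ofReal_mul, Complex.ofReal_cpow ht.le]
    push_cast
    ring

lemma intervalIntegrable_sub_rpow_mul_rpow {p q t : ℝ} (hp : 0 < p) (hq : 0 < q) (ht : 0 < t) :
    IntervalIntegrable (fun s => (t - s) ^ (p - 1) * s ^ (q - 1)) volume 0 t := by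
  refine intervalIntegral.intervalIntegrable_of_integral_ne_zero ?_
  rw [integral_sub_rpow_mul_rpow hp hq ht]
  have := Real.Gamma_pos_of_pos hp
  have := Real.Gamma_pos_of_pos hq
  have := Real.Gamma_pos_of_pos (add_pos hq hp)
  positivity

section Relaxation

variable {α γ p t : ℝ}

lemma intervalIntegrable_sub_rpow_mul_mittagLefflerRelaxation (hα0 : 0 < α) (hα1 : α < 1)
    (hγ : 0 < γ) (hp : 0 < p) (ht : 0 < t) :
    IntervalIntegrable (fun s => (t - s) ^ (p - 1) * mittagLefflerRelaxation α γ s)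
      volume 0 t := by
  simpa only [mittagLefflerRelaxation, mul_assoc, Function.comp_def] using
    (intervalIntegrable_sub_rpow_mul_rpow hp hγ ht).mul_continuousOn
      ((continuous_tsum_neg_pow_div_Gamma hα0 hα1 hγ).comp
        (Real.continuous_rpow_const hα0.le)).continuousOn

lemma integral_sub_rpow_mul_mittagLefflerRelaxation (hα0 : 0 < α) (hα1 : α < 1)
    (hγ : 0 < γ) (hp : 0 < p) (ht : 0 < t) :
    ∫ s in 0..t, (t - s) ^ (p - 1) * mittagLefflerRelaxation α γ s =
      Real.Gamma p * mittagLefflerRelaxation α (γ + p) t := by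
  have hpos (n : ℕ) : 0 < α * n + γ := by positivity
  have hG (n : ℕ) : 0 < Real.Gamma (α * n + γ) := Real.Gamma_pos_of_pos (hpos n)
  let F (n : ℕ) (s : ℝ) : ℝ :=
    ((-1) ^ n / Real.Gamma (α * n + γ)) * ((t - s) ^ (p - 1) * s ^ (α * n + γ - 1))
  have hFint (n : ℕ) : IntegrableOn (F n) (Ioc 0 t) :=
    (intervalIntegrable_iff_integrableOn_Ioc_of_le ht.le).1
      ((intervalIntegrable_sub_rpow_mul_rpow hp (hpos n) ht).const_mul _)
  have hval (n : ℕ) : ∫ s in Ioc 0 t, (t - s) ^ (p - 1) * s ^ (α * n + γ - 1) =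
      t ^ (α * n + (γ + p) - 1) *
        (Real.Gamma p * Real.Gamma (α * n + γ) / Real.Gamma (α * n + (γ + p))) := by
    rw [← intervalIntegral.integral_of_le ht.le, integral_sub_rpow_mul_rpow hp (hpos n) ht,
      add_assoc (α * n)]
  have hsum := (hasSum_mittagLefflerRelaxation hα0 hα1 (add_pos hγ hp) ht).mul_left (Real.Gamma p)
  have hnorm : Summable fun n => ∫ s in Ioc 0 t, ‖F n s‖ := by
    refine hsum.summable.norm.congr fun n => ?_
    have hG' : 0 < Real.Gamma (α * n + (γ + p)) := Real.Gamma_pos_of_pos (by positivity)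
    have hGp := Real.Gamma_pos_of_pos hp
    have h : ∀ s ∈ Ioc 0 t, ‖F n s‖ =
        (Real.Gamma (α * n + γ))⁻¹ * ((t - s) ^ (p - 1) * s ^ (α * n + γ - 1)) := by
      intro s hs
      have h1 := Real.rpow_nonneg (sub_nonneg.2 hs.2) (p - 1)
      have h2 := Real.rpow_nonneg hs.1.le (α * n + γ - 1)
      simp only [F, norm_mul, norm_div, norm_pow, norm_neg, norm_one, one_pow,
        Real.norm_of_nonneg h1, Real.norm_of_nonneg h2, Real.norm_of_nonneg (hG n).le, one_div]
    rw [setIntegral_congr_fun measurableSet_Ioc h, integral_const_mul, hval]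
    have h3 := Real.rpow_nonneg ht.le (α * n + (γ + p) - 1)
    simp only [norm_mul, norm_div, norm_pow, norm_neg, norm_one, one_pow, one_mul,
        Real.norm_of_nonneg h3, Real.norm_of_nonneg hG'.le, Real.norm_of_nonneg hGp.le]
    have := (hG n).ne'
    field_simp
  have h := hasSum_integral_of_summable_integral_norm hFint hnorm
  rw [intervalIntegral.integral_of_le ht.le]
  have hF : ∫ s in Ioc 0 t, ∑' n, F n s =
      ∫ s in Ioc 0 t, (t - s) ^ (p - 1) * mittagLefflerRelaxation α γ s := by
    refine setIntegral_congr_fun measurableSet_Ioc fun s hs => ?_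
    rw [← (hasSum_mittagLefflerRelaxation hα0 hα1 hγ hs.1).tsum_eq, ← tsum_mul_left]
    exact tsum_congr fun n => by simp only [F]; ring
  rw [← hF]
  refine h.unique (hsum.congr_fun fun n => ?_)
  simp only [F]
  rw [integral_const_mul, hval]
  have := (hG n).ne'
  field_simp

lemma intervalIntegrable_mittagLefflerRelaxation (hα0 : 0 < α) (hα1 : α < 1)
    (hγ : 0 < γ) (ht : 0 < t) :
    IntervalIntegrable (mittagLefflerRelaxation α γ) volume 0 t := by
  simpa using intervalIntegrable_sub_rpow_mul_mittagLefflerRelaxation hα0 hα1 hγ one_pos ht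

lemma integral_mittagLefflerRelaxation (hα0 : 0 < α) (hα1 : α < 1) (hγ : 0 < γ) (ht : 0 < t) :
    ∫ s in 0..t, mittagLefflerRelaxation α γ s = mittagLefflerRelaxation α (γ + 1) t := by
  simpa using integral_sub_rpow_mul_mittagLefflerRelaxation hα0 hα1 hγ one_pos ht

end Relaxation

lemma sub_rpow_le_div_rpow_mul {α γ s t u : ℝ} (hαγ : α ≤ γ) (hα1 : α ≤ 1)
    (hs : 0 ≤ s) (hst : s < t) (htu : t ≤ u) :
    (u - s) ^ (α - 1) ≤ (u / t) ^ (γ - 1) * (t - s) ^ (α - 1) := by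
  have hts : 0 < t - s := sub_pos.2 hst
  have ht : 0 < t := hs.trans_lt hst
  have h1 : 1 ≤ u / t := (one_le_div ht).2 htu
  have h2 : u / t ≤ (u - s) / (t - s) := by
    rw [div_le_div_iff₀ ht hts]
    nlinarith
  calc (u - s) ^ (α - 1) = ((u - s) / (t - s)) ^ (α - 1) * (t - s) ^ (α - 1) := by
        rw [← Real.mul_rpow (by linarith) hts.le, div_mul_cancel₀ _ hts.ne']
    _ ≤ (u / t) ^ (α - 1) * (t - s) ^ (α - 1) := by
        gcongr ?_ * _
        exact Real.rpow_le_rpow_of_nonpos (by linarith) h2 (by linarith)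
    _ ≤ (u / t) ^ (γ - 1) * (t - s) ^ (α - 1) := by gcongr

/-- The first-zero comparison: at a first zero `u`, the values just before it would be dominated
by an arbitrarily small multiple of themselves. -/
lemma mittagLefflerRelaxation_div_rpow_mul_le {α γ t u : ℝ} (hα0 : 0 < α) (hα1 : α < 1)
    (hαγ : α ≤ γ) (ht : 0 < t) (htu : t < u)
    (hpos : ∀ s ∈ Ioo 0 u, 0 < mittagLefflerRelaxation α γ s)
    (hu : mittagLefflerRelaxation α γ u ≤ 0)
    (hmax : ∀ s ∈ Icc t u, mittagLefflerRelaxation α γ s ≤ mittagLefflerRelaxation α γ t) :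
    (u / t) ^ (γ - 1) * (Real.Gamma α * mittagLefflerRelaxation α γ t) ≤
      mittagLefflerRelaxation α γ t * ((u - t) ^ α / α) := by
  have hγ : 0 < γ := hα0.trans_le hαγ
  have hu0 : 0 < u := ht.trans htu
  have hGα := Real.Gamma_pos_of_pos hα0
  have hIu := integral_sub_rpow_mul_mittagLefflerRelaxation hα0 hα1 hγ hα0 hu0
  have hIt := integral_sub_rpow_mul_mittagLefflerRelaxation hα0 hα1 hγ hα0 ht
  have hiu := intervalIntegrable_sub_rpow_mul_mittagLefflerRelaxation hα0 hα1 hγ hα0 hu0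
  have hit := intervalIntegrable_sub_rpow_mul_mittagLefflerRelaxation hα0 hα1 hγ hα0 ht
  have hau := mittagLefflerRelaxation_add hα0 hα1 hγ hu0
  have hat := mittagLefflerRelaxation_add hα0 hα1 hγ ht
  have hi1 : IntervalIntegrable (fun s => (u - s) ^ (α - 1) * mittagLefflerRelaxation α γ s)
      volume 0 t :=
    hiu.mono_set (uIcc_subset_uIcc_left (by rw [uIcc_of_le hu0.le]; exact ⟨ht.le, htu.le⟩))
  have hi2 : IntervalIntegrable (fun s => (u - s) ^ (α - 1) * mittagLefflerRelaxation α γ s)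
      volume t u :=
    hiu.mono_set (uIcc_subset_uIcc_right (by rw [uIcc_of_le hu0.le]; exact ⟨ht.le, htu.le⟩))
  have hker : IntervalIntegrable (fun s => (u - s) ^ (α - 1)) volume t u := by
    have h := (intervalIntegral.intervalIntegrable_rpow' (a := u - t) (b := 0)
      (by linarith : -1 < α - 1)).comp_sub_left u
    simpa using h
  have hkerI : ∫ s in t..u, (u - s) ^ (α - 1) = (u - t) ^ α / α := by
    rw [intervalIntegral.integral_comp_sub_left (fun s => s ^ (α - 1)) u, sub_self,
      integral_rpow (.inl (by linarith))]
    simp [Real.zero_rpow hα0.ne']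
  have hsplit := intervalIntegral.integral_add_adjacent_intervals hi1 hi2
  have h1 : ∫ s in 0..t, (u - s) ^ (α - 1) * mittagLefflerRelaxation α γ s ≤
      ∫ s in 0..t, (u / t) ^ (γ - 1) * ((t - s) ^ (α - 1) * mittagLefflerRelaxation α γ s) := by
    refine intervalIntegral.integral_mono_on_of_le_Ioo ht.le hi1 (hit.const_mul _) fun s hs => ?_
    rw [← mul_assoc]
    exact mul_le_mul_of_nonneg_right
      (sub_rpow_le_div_rpow_mul hαγ hα1.le hs.1.le hs.2 htu.le)
      (hpos s ⟨hs.1, hs.2.trans htu⟩).le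
  have h2 : ∫ s in t..u, (u - s) ^ (α - 1) * mittagLefflerRelaxation α γ s ≤
      ∫ s in t..u, (u - s) ^ (α - 1) * mittagLefflerRelaxation α γ t := by
    refine intervalIntegral.integral_mono_on htu.le hi2 (hker.mul_const _) fun s hs => ?_
    exact mul_le_mul_of_nonneg_left (hmax s hs) (Real.rpow_nonneg (sub_nonneg.2 hs.2) _)
  rw [intervalIntegral.integral_const_mul, hIt] at h1
  rw [intervalIntegral.integral_mul_const, hkerI] at h2
  rw [hIu] at hsplit
  have h3 : (u / t) ^ (γ - 1) * (t ^ (γ - 1) / Real.Gamma γ) = u ^ (γ - 1) / Real.Gamma γ := by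
    rw [← mul_div_assoc, ← Real.mul_rpow (by positivity) ht.le, div_mul_cancel₀ _ ht.ne']
  rw [← hat, ← hau] at h3
  have h4 : Real.Gamma α * mittagLefflerRelaxation α γ u ≤ 0 :=
    mul_nonpos_of_nonneg_of_nonpos hGα.le hu
  linear_combination h1 + h2 - hsplit + Real.Gamma α * h3 + h4

lemma mittagLefflerRelaxation_pos {α γ t : ℝ} (hα0 : 0 < α) (hα1 : α < 1) (hαγ : α ≤ γ)
    (ht : 0 < t) : 0 < mittagLefflerRelaxation α γ t := by
  have hγ : 0 < γ := hα0.trans_le hαγ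
  have hcont := continuousOn_mittagLefflerRelaxation hα0 hα1 hγ
  by_contra! hneg
  obtain ⟨δ, hδ0, hδ⟩ := (nhdsGT_basis (0 : ℝ)).eventually_iff.1
    (eventually_mittagLefflerRelaxation_pos hα0 hα1 hγ)
  let B : Set ℝ := Ici δ ∩ mittagLefflerRelaxation α γ ⁻¹' Iic 0
  have hmem {s : ℝ} (hs : 0 < s) (hs' : mittagLefflerRelaxation α γ s ≤ 0) : s ∈ B :=
    ⟨not_lt.1 fun h => hs'.not_gt (hδ ⟨hs, h⟩), hs'⟩
  have hB : IsClosed B := (hcont.mono fun s hs => hδ0.trans_le hs).preimage_isClosed_of_isClosed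
    isClosed_Ici isClosed_Iic
  have hBb : BddBelow B := ⟨δ, fun s hs => hs.1⟩
  set u := sInf B
  obtain ⟨huδ, hu⟩ : u ∈ B := hB.csInf_mem ⟨t, hmem ht hneg⟩ hBb
  have hu0 : 0 < u := hδ0.trans_le huδ
  have hpos : ∀ s ∈ Ioo 0 u, 0 < mittagLefflerRelaxation α γ s := fun s hs =>
    not_le.1 fun h => (csInf_le hBb (hmem hs.1 h)).not_gt hs.2
  have hGα := Real.Gamma_pos_of_pos hα0
  have hlim : Tendsto (fun c : ℝ => (u - c) ^ α / α) (𝓝[<] u) (𝓝 0) := by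
    have : ContinuousAt (fun c : ℝ => (u - c) ^ α / α) u :=
      ((continuousAt_const.sub continuousAt_id).rpow_const (.inr hα0.le)).div_const _
    simpa [ContinuousAt, Real.zero_rpow hα0.ne'] using this.mono_left nhdsWithin_le_nhds
  obtain ⟨c, hc, hcu, hc2⟩ := ((hlim.eventually_lt_const (half_pos hGα)).and
    (Ioo_mem_nhdsLT (half_lt_self hu0))).exists
  have hc0 : 0 < c := (half_pos hu0).trans hcu
  obtain ⟨m, hm, hmax⟩ := isCompact_Icc.exists_isMaxOn (nonempty_Icc.2 hc2.le)
    (hcont.mono fun s (hs : s ∈ Icc c u) => hc0.trans_le hs.1)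
  have hm0 : 0 < m := hc0.trans_le hm.1
  have hfm : 0 < mittagLefflerRelaxation α γ m :=
    (hpos c ⟨hc0, hc2⟩).trans_le (hmax (left_mem_Icc.2 hc2.le))
  have hmu : m < u := lt_of_le_of_ne hm.2 fun h => (h ▸ hfm).not_ge hu
  have key := mittagLefflerRelaxation_div_rpow_mul_le hα0 hα1 hαγ hm0 hmu hpos hu
    fun s hs => hmax ⟨hm.1.trans hs.1, hs.2⟩
  have hratio : 1 / 2 ≤ (u / m) ^ (γ - 1) := by
    calc (1 : ℝ) / 2 ≤ (u / m)⁻¹ := by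
          rw [inv_div, div_le_div_iff₀ two_pos hu0]
          linarith [hm.1]
      _ = (u / m) ^ (-1 : ℝ) := (Real.rpow_neg_one _).symm
      _ ≤ _ := Real.rpow_le_rpow_of_exponent_le ((one_le_div hm0).2 hm.2) (by linarith)
  have hsmall : (u - m) ^ α / α < Real.Gamma α / 2 := by
    refine lt_of_le_of_lt ?_ hc
    have := hm.1
    have : 0 ≤ u - m := by linarith
    gcongr
  have h1 := mul_le_mul_of_nonneg_right hratio (mul_pos hGα hfm).le
  have h2 := mul_lt_mul_of_pos_left hsmall hfm
  linarith

section Asymptotics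

variable {α s t : ℝ}

lemma mittagLefflerRelaxation_one_add_integral (hα0 : 0 < α) (hα1 : α < 1) (ht : 0 < t) :
    mittagLefflerRelaxation α 1 t + ∫ s in 0..t, mittagLefflerRelaxation α α s = 1 := by
  rw [integral_mittagLefflerRelaxation hα0 hα1 hα0 ht, add_comm α,
    mittagLefflerRelaxation_add hα0 hα1 one_pos ht]
  simp

lemma mittagLefflerRelaxation_one_antitoneOn (hα0 : 0 < α) (hα1 : α < 1) :
    AntitoneOn (mittagLefflerRelaxation α 1) (Ioi 0) := by
  intro s hs t ht hst
  have hs0 : 0 < s := hs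
  have ht0 : 0 < t := ht
  have h1 := mittagLefflerRelaxation_one_add_integral hα0 hα1 hs0
  have h2 := mittagLefflerRelaxation_one_add_integral hα0 hα1 ht0
  have h3 := intervalIntegral.integral_mono_interval le_rfl hs0.le hst
    ((ae_restrict_mem measurableSet_Ioc).mono fun x hx =>
      (mittagLefflerRelaxation_pos hα0 hα1 le_rfl hx.1).le)
    (intervalIntegrable_mittagLefflerRelaxation hα0 hα1 hα0 ht0)
  linarith

lemma integral_sub_rpow {p : ℝ} (hp : 0 < p) (ht : 0 < t) :
    ∫ s in 0..t, (t - s) ^ (p - 1) = t ^ p / p := by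
  have h := integral_sub_rpow_mul_rpow hp one_pos ht
  simp only [sub_self, Real.rpow_zero, mul_one, Real.Gamma_one, add_sub_cancel_left] at h
  rw [h, add_comm, Real.Gamma_add_one hp.ne']
  have := (Real.Gamma_pos_of_pos hp).ne'
  field_simp

lemma intervalIntegrable_sub_rpow {p : ℝ} (hp : 0 < p) (ht : 0 < t) :
    IntervalIntegrable (fun s => (t - s) ^ (p - 1)) volume 0 t := by
  simpa using intervalIntegrable_sub_rpow_mul_rpow hp one_pos ht

lemma mittagLefflerRelaxation_one_le (hα0 : 0 < α) (hα1 : α < 1) (ht : 0 < t) :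
    mittagLefflerRelaxation α 1 t ≤ Real.Gamma (α + 1) * t ^ (-α) := by
  have hG := Real.Gamma_pos_of_pos hα0
  have hadd := mittagLefflerRelaxation_add hα0 hα1 one_pos ht
  have hpos := mittagLefflerRelaxation_pos hα0 hα1 hα1.le ht
  have h : ∫ s in 0..t, (t - s) ^ (α - 1) * mittagLefflerRelaxation α 1 t ≤
      ∫ s in 0..t, (t - s) ^ (α - 1) * mittagLefflerRelaxation α 1 s := by
    refine intervalIntegral.integral_mono_on_of_le_Ioo ht.le
      ((intervalIntegrable_sub_rpow hα0 ht).mul_const _)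
      (intervalIntegrable_sub_rpow_mul_mittagLefflerRelaxation hα0 hα1 one_pos hα0 ht)
      fun s hs => ?_
    exact mul_le_mul_of_nonneg_left
      (mittagLefflerRelaxation_one_antitoneOn hα0 hα1 hs.1 ht hs.2.le)
      (Real.rpow_nonneg (sub_nonneg.2 hs.2.le) _)
  rw [intervalIntegral.integral_mul_const, integral_sub_rpow hα0 ht,
    integral_sub_rpow_mul_mittagLefflerRelaxation hα0 hα1 one_pos hα0 ht] at h
  simp only [sub_self, Real.rpow_zero, Real.Gamma_one, div_one] at hadd
  have h1 : t ^ α / α * mittagLefflerRelaxation α 1 t ≤ Real.Gamma α := by nlinarith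
  rw [Real.Gamma_add_one hα0.ne', Real.rpow_neg ht.le, ← div_eq_mul_inv,
    le_div_iff₀ (Real.rpow_pos_of_pos ht α)]
  rw [div_mul_eq_mul_div, div_le_iff₀ hα0] at h1
  linarith

lemma mittagLefflerRelaxation_two_sub_le (hα0 : 0 < α) (hα1 : α < 1) :
    ∃ C : ℝ, ∀ t > 0, mittagLefflerRelaxation α (2 - α) t ≤ C * t ^ (1 - 2 * α) := by
  have hα : 0 < 1 - α := sub_pos.2 hα1
  have hG := Real.Gamma_pos_of_pos hα
  refine ⟨Real.Gamma (α + 1) *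
    (Real.Gamma (1 - α) * Real.Gamma (1 - α) / Real.Gamma (1 - α + (1 - α))) /
      Real.Gamma (1 - α), fun t ht => ?_⟩
  have h : ∫ s in 0..t, (t - s) ^ (1 - α - 1) * mittagLefflerRelaxation α 1 s ≤
      ∫ s in 0..t, Real.Gamma (α + 1) * ((t - s) ^ (1 - α - 1) * s ^ (1 - α - 1)) := by
    refine intervalIntegral.integral_mono_on_of_le_Ioo ht.le
      (intervalIntegrable_sub_rpow_mul_mittagLefflerRelaxation hα0 hα1 one_pos hα ht)
      ((intervalIntegrable_sub_rpow_mul_rpow hα hα ht).const_mul _) fun s hs => ?_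
    rw [mul_left_comm]
    refine mul_le_mul_of_nonneg_left ?_ (Real.rpow_nonneg (sub_nonneg.2 hs.2.le) _)
    simpa using mittagLefflerRelaxation_one_le hα0 hα1 hs.1
  rw [intervalIntegral.integral_const_mul, integral_sub_rpow_mul_rpow hα hα ht,
    integral_sub_rpow_mul_mittagLefflerRelaxation hα0 hα1 one_pos hα ht,
    show (1 : ℝ) + (1 - α) = 2 - α by ring,
    show 1 - α + (1 - α) - 1 = 1 - 2 * α by ring] at h
  rw [div_mul_eq_mul_div, le_div_iff₀ hG]
  linarith

lemma rpow_neg_mul_one_sub_le_mittagLefflerRelaxation_one (hα0 : 0 < α) (hα1 : α < 1)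
    (ht : 0 < t) :
    t ^ (-α) * (1 - mittagLefflerRelaxation α 1 t) ≤
      Real.Gamma (1 - α) * mittagLefflerRelaxation α 1 t := by
  have hα : 0 < 1 - α := sub_pos.2 hα1
  have hI := integral_sub_rpow_mul_mittagLefflerRelaxation hα0 hα1 hα0 hα ht
  rw [add_sub_cancel] at hI
  rw [← hI, ← eq_sub_of_add_eq' (mittagLefflerRelaxation_one_add_integral hα0 hα1 ht),
    ← intervalIntegral.integral_const_mul]
  refine intervalIntegral.integral_mono_on_of_le_Ioo ht.le
    ((intervalIntegrable_mittagLefflerRelaxation hα0 hα1 hα0 ht).const_mul _)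
    (intervalIntegrable_sub_rpow_mul_mittagLefflerRelaxation hα0 hα1 hα0 hα ht) fun s hs => ?_
  refine mul_le_mul_of_nonneg_right ?_ (mittagLefflerRelaxation_pos hα0 hα1 le_rfl hs.1).le
  rw [show 1 - α - 1 = -α by ring]
  exact Real.rpow_le_rpow_of_nonpos (sub_pos.2 hs.2) (by linarith [hs.1]) (by linarith)

lemma sub_mul_mittagLefflerRelaxation_one_le (hα0 : 0 < α) (hα1 : α < 1) (hs : 0 < s)
    (hst : s ≤ t) :
    (t - s) * mittagLefflerRelaxation α 1 t ≤
      (t ^ (1 - α) - s ^ (1 - α)) / Real.Gamma (2 - α) + mittagLefflerRelaxation α (2 - α) s := by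
  have ht : 0 < t := hs.trans_le hst
  have hi1 := intervalIntegrable_mittagLefflerRelaxation hα0 hα1 one_pos hs
  have hi2 : IntervalIntegrable (mittagLefflerRelaxation α 1) volume s t :=
    (intervalIntegrable_mittagLefflerRelaxation hα0 hα1 one_pos ht).mono_set
      (uIcc_subset_uIcc_right (by rw [uIcc_of_le ht.le]; exact ⟨hs.le, hst⟩))
  have hsplit := intervalIntegral.integral_add_adjacent_intervals hi1 hi2
  rw [integral_mittagLefflerRelaxation hα0 hα1 one_pos hs,
    integral_mittagLefflerRelaxation hα0 hα1 one_pos ht] at hsplit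
  have h2α : 0 < 2 - α := by linarith
  have hadd {x : ℝ} (hx : 0 < x) := mittagLefflerRelaxation_add hα0 hα1 h2α hx
  simp only [sub_add_cancel, show 2 - α - 1 = 1 - α by ring] at hadd
  have hpos := mittagLefflerRelaxation_pos (γ := 2 - α) hα0 hα1 (by linarith) ht
  have hmono := intervalIntegral.integral_mono_on hst intervalIntegrable_const hi2 fun x hx =>
    mittagLefflerRelaxation_one_antitoneOn hα0 hα1 (hs.trans_le hx.1) ht hx.2
  rw [intervalIntegral.integral_const, smul_eq_mul] at hmono
  rw [one_add_one_eq_two] at hsplit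
  rw [sub_div, ← hadd ht, ← hadd hs]
  linarith

lemma tendsto_rpow_mul_mittagLefflerRelaxation_one (hα0 : 0 < α) (hα1 : α < 1) :
    Tendsto (fun t => t ^ α * (Real.Gamma (1 - α) * mittagLefflerRelaxation α 1 t))
      atTop (𝓝 1) := by
  have hα : 0 < 1 - α := sub_pos.2 hα1
  have hG := Real.Gamma_pos_of_pos hα
  have hdecay := tendsto_rpow_neg_atTop hα0
  refine tendsto_order.2 ⟨fun a ha => ?_, fun b hb => ?_⟩
  · have h : Tendsto (fun t : ℝ => 1 - Real.Gamma (α + 1) * t ^ (-α)) atTop (𝓝 1) := by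
      simpa using (hdecay.const_mul (Real.Gamma (α + 1))).const_sub 1
    filter_upwards [h.eventually_const_lt ha, eventually_gt_atTop 0] with t hlt ht
    have h1 := mul_le_mul_of_nonneg_left
      (rpow_neg_mul_one_sub_le_mittagLefflerRelaxation_one hα0 hα1 ht) (Real.rpow_nonneg ht.le α)
    rw [← mul_assoc, ← Real.rpow_add ht, add_neg_cancel, Real.rpow_zero, one_mul] at h1
    linarith [mittagLefflerRelaxation_one_le hα0 hα1 ht]
  · obtain ⟨C, hC⟩ := mittagLefflerRelaxation_two_sub_le hα0 hα1
    have hslope : Tendsto (fun c : ℝ => (1 - c ^ (1 - α)) / ((1 - α) * (1 - c)))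
        (𝓝[<] 1) (𝓝 1) := by
      have hd := (Real.hasDerivAt_rpow_const (x := 1) (p := 1 - α) (.inl one_ne_zero)).tendsto_slope
      have hd' := (hd.mono_left (nhdsWithin_mono 1
        fun x (hx : x < 1) => hx.ne)).div_const (1 - α)
      rw [Real.one_rpow, mul_one, div_self hα.ne'] at hd'
      refine hd'.congr' ?_
      filter_upwards [self_mem_nhdsWithin] with c hc
      have : c - 1 ≠ 0 := sub_ne_zero.2 (ne_of_lt hc)
      have : 1 - c ≠ 0 := sub_ne_zero.2 (ne_of_gt hc)
      rw [slope_def_field, Real.one_rpow]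
      field_simp
      ring
    obtain ⟨c, hcb, hc0, hc1⟩ := ((hslope.eventually_lt_const hb).and
      (Ioo_mem_nhdsLT (zero_lt_one' ℝ))).exists
    have h : Tendsto (fun t : ℝ => (1 - c ^ (1 - α)) / ((1 - α) * (1 - c)) +
        Real.Gamma (1 - α) * C * c ^ (1 - 2 * α) / (1 - c) * t ^ (-α)) atTop
        (𝓝 ((1 - c ^ (1 - α)) / ((1 - α) * (1 - c)))) := by
      simpa using (hdecay.const_mul
        (Real.Gamma (1 - α) * C * c ^ (1 - 2 * α) / (1 - c))).const_add
          ((1 - c ^ (1 - α)) / ((1 - α) * (1 - c)))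
    filter_upwards [h.eventually_lt_const hcb, eventually_gt_atTop 0] with t hlt ht
    refine lt_of_le_of_lt ?_ hlt
    have hc : 0 < 1 - c := sub_pos.2 hc1
    have h1 := (sub_mul_mittagLefflerRelaxation_one_le hα0 hα1 (mul_pos hc0 ht)
      (mul_le_of_le_one_left ht.le hc1.le)).trans (add_le_add_right (hC _ (mul_pos hc0 ht)) _)
    have e1 : t ^ (1 - α) = t * t ^ (-α) := by
      rw [sub_eq_add_neg, Real.rpow_add ht, Real.rpow_one]
    have e2 : t ^ (1 - 2 * α) = t * t ^ (-α) * t ^ (-α) := by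
      rw [← e1, ← Real.rpow_add ht]
      ring_nf
    have e3 : t ^ α * t ^ (-α) = 1 := by
      rw [← Real.rpow_add ht, add_neg_cancel, Real.rpow_zero]
    have e4 : Real.Gamma (2 - α) = (1 - α) * Real.Gamma (1 - α) := by
      rw [← Real.Gamma_add_one hα.ne']
      ring_nf
    rw [Real.mul_rpow hc0.le ht.le, Real.mul_rpow hc0.le ht.le, e1, e2, e4] at h1
    have hk : 0 < t ^ α * Real.Gamma (1 - α) / (t * (1 - c)) := by
      have := Real.rpow_pos_of_pos ht α
      positivity
    have h2 := mul_le_mul_of_nonneg_left h1 hk.le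
    have htα := (Real.rpow_pos_of_pos ht α).ne'
    have e5 : t ^ (-α) = (t ^ α)⁻¹ := Real.rpow_neg ht.le α
    rw [e5] at h2 ⊢
    convert h2 using 1
    · field_simp
    · field_simp

end Asymptotics

/-- For `0 < α < 1`, `E_α(-t^α) ~ t^(-α)/Γ(1-α)` as `t → ∞`: the ratio tends
to `1`. -/
theorem mittagLeffler_asymptotic
    (α : ℝ) (hα0 : 0 < α) (hα1 : α < 1) :
    Tendsto (fun t : ℝ =>
        mittagLeffler α (-(t ^ α)) / (t ^ (-α) / Real.Gamma (1 - α)))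
      atTop (nhds 1) := by
  refine (tendsto_rpow_mul_mittagLefflerRelaxation_one hα0 hα1).congr' ?_
  filter_upwards [eventually_gt_atTop 0] with t ht
  rw [mittagLefflerRelaxation_one, Real.rpow_neg ht.le, div_div_eq_mul_div, div_inv_eq_mul]
  ring
end

section
/- Let 0 < α < 1. Then for every t > 0, E_{α,α}(-t^α) > 0; consequently the function -Φ_α(t) = t^{α-1} E_{α,α}(-t^α) is strictly positive for t > 0, where Φ_α(t) = (d/dt) E_α(-t^α). -/
/-- The two-parameter Mittag-Leffler function `E_{α,β}(x) = ∑ xⁿ / Γ(αn + β)`. -/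
noncomputable def mittagLeffler2 (α β x : ℝ) : ℝ :=
  ∑' n : ℕ, x ^ n / Real.Gamma (α * n + β)

section

open MeasureTheory Set Filter Topology

/-- The real Beta integral over `[0, a]`. -/
theorem integral_rpow_mul_sub_rpow {s t a : ℝ} (hs : 0 < s) (ht : 0 < t) (ha : 0 < a) :
    ∫ x in (0 : ℝ)..a, x ^ (s - 1) * (a - x) ^ (t - 1) =
      a ^ (s + t - 1) * (Real.Gamma s * Real.Gamma t / Real.Gamma (s + t)) := by
  have h := Complex.betaIntegral_scaled s t ha
  rw [Complex.betaIntegral_eq_Gamma_mul_div (s : ℂ) t (by simpa) (by simpa)] at h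
  apply Complex.ofReal_injective
  rw [← intervalIntegral.integral_ofReal]
  push_cast [Complex.ofReal_cpow ha.le, Complex.Gamma_ofReal] at h ⊢
  simp only [← Complex.ofReal_add, Complex.Gamma_ofReal] at h ⊢
  rw [← h]
  refine intervalIntegral.integral_congr fun x hx ↦ ?_
  rw [uIcc_of_le ha.le] at hx
  rw [Complex.ofReal_cpow hx.1, Complex.ofReal_cpow (sub_nonneg.2 hx.2)]
  push_cast
  rfl

theorem intervalIntegrable_rpow_mul_sub_rpow {s t a : ℝ} (hs : 0 < s) (ht : 0 < t) (ha : 0 < a) :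
    IntervalIntegrable (fun x : ℝ ↦ x ^ (s - 1) * (a - x) ^ (t - 1)) volume 0 a := by
  by_contra h
  have h0 := integral_rpow_mul_sub_rpow hs ht ha
  rw [intervalIntegral.integral_undef h] at h0
  have := Real.Gamma_pos_of_pos hs
  have := Real.Gamma_pos_of_pos ht
  have := Real.Gamma_pos_of_pos (add_pos hs ht)
  have : 0 < a ^ (s + t - 1) * (Real.Gamma s * Real.Gamma t / Real.Gamma (s + t)) := by
    positivity
  exact this.ne h0

theorem exp_neg_mul_rpow_le_Gamma {R y : ℝ} (hR : 0 < R) (hy : 1 ≤ y) :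
    Real.exp (-R) * R ^ (y - 1) ≤ Real.Gamma y := by
  have hy0 : 0 < y := by linarith
  rw [Real.Gamma_eq_integral hy0, ← integral_exp_neg_Ioi, ← integral_mul_const]
  calc ∫ x in Ioi R, Real.exp (-x) * R ^ (y - 1)
      ≤ ∫ x in Ioi R, Real.exp (-x) * x ^ (y - 1) := by
        refine setIntegral_mono_on ((integrableOn_exp_neg_Ioi R).mul_const _)
          ((Real.GammaIntegral_convergent hy0).mono_set (Ioi_subset_Ioi hR.le))
          measurableSet_Ioi fun x hx ↦ ?_
        have hx' : R < x := hx
        gcongr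
    _ ≤ ∫ x in Ioi 0, Real.exp (-x) * x ^ (y - 1) := by
        refine setIntegral_mono_set (Real.GammaIntegral_convergent hy0) ?_
          (Ioi_subset_Ioi hR.le).eventuallyLE
        filter_upwards [ae_restrict_mem measurableSet_Ioi] with x hx
        have hx' : 0 < x := hx
        simp only [Pi.zero_apply]
        positivity

theorem summable_mittagLeffler2 {α β : ℝ} (hα : 0 < α) (hβ : 0 < β) (x : ℝ) :
    Summable fun n : ℕ ↦ x ^ n / Real.Gamma (α * n + β) := by
  set R : ℝ := (2 * (|x| + 1)) ^ (1 / α) with hR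
  have hR0 : 0 < R := by positivity
  have hRα : R ^ α = 2 * (|x| + 1) := by
    rw [hR, ← Real.rpow_mul (by positivity), one_div_mul_cancel hα.ne', Real.rpow_one]
  have hgeo : Summable fun n : ℕ ↦ Real.exp R * R ^ (1 - β) * (1 / 2 : ℝ) ^ n :=
    summable_geometric_two.mul_left _
  refine Summable.of_norm_bounded_eventually_nat hgeo ?_
  filter_upwards [eventually_ge_atTop ⌈1 / α⌉₊] with n hn
  have hn1 : 1 ≤ α * n := by
    have := Nat.ceil_le.1 hn
    rwa [div_le_iff₀' hα] at this
  have hΓ := exp_neg_mul_rpow_le_Gamma hR0 (y := α * n + β) (by linarith)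
  have hΓ0 : 0 < Real.Gamma (α * n + β) := Real.Gamma_pos_of_pos (by linarith)
  have hpow : R ^ (α * n + β - 1) = (2 * (|x| + 1)) ^ n * R ^ (β - 1) := by
    rw [add_sub_assoc, Real.rpow_add hR0, Real.rpow_mul hR0.le, hRα, Real.rpow_natCast]
  have hcancel : R ^ (1 - β) * R ^ (β - 1) = 1 := by
    rw [← Real.rpow_add hR0]; simp
  have hexp : Real.exp R * Real.exp (-R) = 1 := by rw [← Real.exp_add]; simp
  rw [norm_div, norm_pow, Real.norm_eq_abs, Real.norm_of_nonneg hΓ0.le, div_le_iff₀ hΓ0]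
  calc |x| ^ n ≤ (|x| + 1) ^ n := by gcongr; linarith
    _ = Real.exp R * R ^ (1 - β) * (1 / 2 : ℝ) ^ n *
        (Real.exp (-R) * R ^ (α * n + β - 1)) := by
      rw [hpow, mul_pow]
      have h2 : (1 / 2 : ℝ) ^ n * 2 ^ n = 1 := by rw [← mul_pow]; norm_num
      calc (|x| + 1) ^ n = (Real.exp R * Real.exp (-R)) * (R ^ (1 - β) * R ^ (β - 1)) *
            ((1 / 2 : ℝ) ^ n * 2 ^ n) * (|x| + 1) ^ n := by rw [hexp, hcancel, h2]; ring
        _ = _ := by ring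
    _ ≤ _ := by gcongr

theorem continuous_mittagLeffler2 {α β : ℝ} (hα : 0 < α) (hβ : 0 < β) :
    Continuous (mittagLeffler2 α β) := by
  rw [continuous_iff_continuousAt]
  intro x
  have h : ContinuousOn (mittagLeffler2 α β) (Icc (x - 1) (x + 1)) := by
    refine continuousOn_tsum (u := fun n : ℕ ↦ (|x| + 1) ^ n / Real.Gamma (α * n + β))
      (fun n ↦ by fun_prop) (summable_mittagLeffler2 hα hβ _) fun n y hy ↦ ?_
    have hΓ0 : 0 < Real.Gamma (α * n + β) := Real.Gamma_pos_of_pos (by positivity)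
    rw [norm_div, norm_pow, Real.norm_eq_abs, Real.norm_of_nonneg hΓ0.le]
    have : |y| ≤ |x| + 1 := by
      have := abs_sub_abs_le_abs_sub y x
      have : |y - x| ≤ 1 := abs_le.2 ⟨by linarith [hy.1], by linarith [hy.2]⟩
      linarith
    gcongr
  exact h.continuousAt (Icc_mem_nhds (by linarith) (by linarith))

theorem mittagLeffler2_zero (α β : ℝ) : mittagLeffler2 α β 0 = 1 / Real.Gamma β := by
  rw [mittagLeffler2, tsum_eq_single 0 fun n hn ↦ by simp [hn]]
  simp

/-- `u(t) = t^(α-1) E_{α,α}(-t^α)` solves the Volterra equation `u + k * u = k` with kernel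
`k(t) = t^(α-1) / Γ(α)`. -/
theorem integral_mittagLeffler2_volterra {α t : ℝ} (hα : 0 < α) (ht : 0 < t) :
    ∫ s in (0 : ℝ)..t, s ^ (α - 1) * (t - s) ^ (α - 1) * mittagLeffler2 α α (-(s ^ α)) =
      t ^ (α - 1) - Real.Gamma α * (t ^ (α - 1) * mittagLeffler2 α α (-(t ^ α))) := by
  have hΓ (n : ℕ) : 0 < Real.Gamma (α * n + α) := Real.Gamma_pos_of_pos (by positivity)
  have hΓα := Real.Gamma_pos_of_pos hα
  set a : ℕ → ℝ := fun n ↦ (-(t ^ α)) ^ n / Real.Gamma (α * n + α) with ha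
  have hsum : Summable a := summable_mittagLeffler2 hα hα _
  set F : ℕ → ℝ → ℝ := fun n s ↦
    (-1) ^ n / Real.Gamma (α * n + α) * (s ^ (α * n + α - 1) * (t - s) ^ (α - 1)) with hF
  have hbeta (n : ℕ) : ∫ s in Ioc 0 t, s ^ (α * n + α - 1) * (t - s) ^ (α - 1) =
      Real.Gamma α * t ^ (α - 1) * (t ^ α) ^ (n + 1) *
        (Real.Gamma (α * n + α) / Real.Gamma (α * (n + 1 : ℕ) + α)) := by
    rw [← intervalIntegral.integral_of_le ht.le,
      integral_rpow_mul_sub_rpow (by positivity) hα ht]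
    rw [show α * n + α + α - 1 = (α - 1) + α * (n + 1 : ℕ) by push_cast; ring,
      Real.rpow_add ht, Real.rpow_mul ht.le, Real.rpow_natCast,
      show α * n + α + α = α * (n + 1 : ℕ) + α by push_cast; ring]
    ring
  have hFint (n : ℕ) : Integrable (F n) (volume.restrict (Ioc 0 t)) :=
    (((intervalIntegrable_iff_integrableOn_Ioc_of_le ht.le).1
      (intervalIntegrable_rpow_mul_sub_rpow (by positivity) hα ht)).const_mul _)
  have hnorm (n : ℕ) : ∫ s in Ioc 0 t, ‖F n s‖ = Real.Gamma α * t ^ (α - 1) * ‖a (n + 1)‖ := by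
    have h1 : ∫ s in Ioc 0 t, ‖F n s‖ = ∫ s in Ioc 0 t,
        1 / Real.Gamma (α * n + α) * (s ^ (α * n + α - 1) * (t - s) ^ (α - 1)) := by
      refine setIntegral_congr_fun measurableSet_Ioc fun s hs ↦ ?_
      have h2 : 0 ≤ s ^ (α * n + α - 1) * (t - s) ^ (α - 1) :=
        mul_nonneg (Real.rpow_nonneg hs.1.le _) (Real.rpow_nonneg (sub_nonneg.2 hs.2) _)
      simp only [hF, norm_mul, norm_div, norm_pow, norm_neg, norm_one, one_pow,
        Real.norm_of_nonneg (hΓ n).le]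
      rw [← norm_mul, Real.norm_of_nonneg h2]
    rw [h1, integral_const_mul, hbeta]
    have h3 : ‖t ^ α‖ = t ^ α := Real.norm_of_nonneg (by positivity)
    simp only [ha, norm_div, norm_pow, norm_neg, h3, Real.norm_of_nonneg (hΓ (n + 1)).le]
    field_simp [(hΓ n).ne']
  have hii (n : ℕ) : ∫ s in Ioc 0 t, F n s = -(Real.Gamma α * t ^ (α - 1)) * a (n + 1) := by
    simp only [hF]
    rw [integral_const_mul, hbeta]
    simp only [ha]
    rw [neg_pow (t ^ α)]
    have := (hΓ n).ne'
    have := (hΓ (n + 1)).ne'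
    field_simp
    ring
  have hsucc : Summable fun n ↦ a (n + 1) := (summable_nat_add_iff 1).2 hsum
  have key := hasSum_integral_of_summable_integral_norm hFint
    (by simp only [hnorm]; exact hsucc.norm.mul_left _)
  have htsum : ∑' n, a (n + 1) = mittagLeffler2 α α (-(t ^ α)) - 1 / Real.Gamma α := by
    have := hsum.tsum_eq_zero_add
    rw [mittagLeffler2, this]
    simp [ha]
  have hleft : ∫ s in Ioc 0 t, ∑' n, F n s =
      ∫ s in Ioc 0 t, s ^ (α - 1) * (t - s) ^ (α - 1) * mittagLeffler2 α α (-(s ^ α)) := by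
    refine setIntegral_congr_fun measurableSet_Ioc fun s hs ↦ ?_
    simp only [mittagLeffler2]
    rw [← tsum_mul_left]
    refine tsum_congr fun n ↦ ?_
    simp only [hF]
    rw [neg_pow (s ^ α), show α * n + α - 1 = (α - 1) + α * n by ring, Real.rpow_add hs.1,
      Real.rpow_mul hs.1.le, Real.rpow_natCast]
    ring
  rw [intervalIntegral.integral_of_le ht.le, ← hleft, ← key.tsum_eq]
  simp only [hii]
  rw [tsum_mul_left, htsum]
  field_simp
  ring

/-- The main estimate: if `u(s) = s^(α-1) e(s)` solves `u + k * u = k`, is nonnegative up to `T`, and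
is bounded by `u(t)` on `[t, T]` with `t` close to `T`, then `u(T) > 0`. -/
theorem mittagLeffler2_pos_of_forall_le {α t T : ℝ} (hα0 : 0 < α) (hα1 : α < 1) (ht : 0 < t)
    (htT : t < T) (hpos : ∀ s ∈ Icc 0 t, 0 < mittagLeffler2 α α (-(s ^ α)))
    (hmax : ∀ s ∈ Icc t T, s ^ (α - 1) * mittagLeffler2 α α (-(s ^ α)) ≤
      t ^ (α - 1) * mittagLeffler2 α α (-(t ^ α)))
    (hclose : (T - t) ^ α / α * t ^ (α - 1) < Real.Gamma α * T ^ (α - 1)) :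
    0 < mittagLeffler2 α α (-(T ^ α)) := by
  have hT : 0 < T := ht.trans htT
  set e : ℝ → ℝ := fun s ↦ mittagLeffler2 α α (-(s ^ α)) with he
  have hecont : Continuous e :=
    (continuous_mittagLeffler2 hα0 hα0).comp (Real.continuous_rpow_const hα0.le).neg
  have hii {r : ℝ} (hr : 0 < r) :
      IntervalIntegrable (fun s ↦ s ^ (α - 1) * (r - s) ^ (α - 1) * e s) volume 0 r :=
    (intervalIntegrable_rpow_mul_sub_rpow hα0 hα0 hr).mul_continuousOn hecont.continuousOn
  have hVt := integral_mittagLeffler2_volterra hα0 ht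
  have hVT := integral_mittagLeffler2_volterra hα0 hT
  have hΓ := Real.Gamma_pos_of_pos hα0
  have hii1 : IntervalIntegrable (fun s ↦ s ^ (α - 1) * (T - s) ^ (α - 1) * e s) volume 0 t :=
    (hii hT).mono_set (by
      rw [uIcc_of_le ht.le, uIcc_of_le hT.le]; exact Icc_subset_Icc_right htT.le)
  have hii2 : IntervalIntegrable (fun s ↦ s ^ (α - 1) * (T - s) ^ (α - 1) * e s) volume t T :=
    (hii hT).mono_set (by
      rw [uIcc_of_le htT.le, uIcc_of_le hT.le]; exact Icc_subset_Icc_left ht.le)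
  have hsplit := intervalIntegral.integral_add_adjacent_intervals hii1 hii2
  have hfirst : ∫ s in (0 : ℝ)..t, s ^ (α - 1) * (T - s) ^ (α - 1) * e s ≤
      T ^ (α - 1) / t ^ (α - 1) * ∫ s in (0 : ℝ)..t, s ^ (α - 1) * (t - s) ^ (α - 1) * e s := by
    rw [← intervalIntegral.integral_const_mul]
    refine intervalIntegral.integral_mono_on_of_le_Ioo ht.le hii1 ((hii ht).const_mul _)
      fun s hs ↦ ?_
    have hs0 : 0 < s := hs.1
    have hst : 0 < t - s := sub_pos.2 hs.2
    have hsT : 0 < T - s := by linarith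
    have hkey : (T - s) ^ (α - 1) * t ^ (α - 1) ≤ T ^ (α - 1) * (t - s) ^ (α - 1) := by
      rw [← Real.mul_rpow hsT.le ht.le, ← Real.mul_rpow hT.le hst.le]
      exact Real.rpow_le_rpow_of_nonpos (by positivity) (by nlinarith) (by linarith)
    have hkey' : (T - s) ^ (α - 1) ≤ T ^ (α - 1) / t ^ (α - 1) * (t - s) ^ (α - 1) := by
      rw [div_mul_eq_mul_div, le_div_iff₀ (by positivity)]
      exact hkey
    have hes : 0 < e s := hpos s ⟨hs0.le, hs.2.le⟩
    calc s ^ (α - 1) * (T - s) ^ (α - 1) * e s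
        ≤ s ^ (α - 1) * (T ^ (α - 1) / t ^ (α - 1) * (t - s) ^ (α - 1)) * e s := by gcongr
      _ = _ := by ring
  have hpowint : IntervalIntegrable (fun s ↦ (T - s) ^ (α - 1)) volume t T := by
    have := (intervalIntegral.intervalIntegrable_rpow' (a := T - t) (b := 0) (r := α - 1)
      (by linarith)).comp_sub_left T
    simpa using this
  have hpow : ∫ s in t..T, (T - s) ^ (α - 1) = (T - t) ^ α / α := by
    rw [intervalIntegral.integral_comp_sub_left (fun s ↦ s ^ (α - 1)) T,
      integral_rpow (Or.inl (by linarith))]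
    simp [Real.zero_rpow hα0.ne']
  have hsecond : ∫ s in t..T, s ^ (α - 1) * (T - s) ^ (α - 1) * e s ≤
      (T - t) ^ α / α * (t ^ (α - 1) * e t) := by
    rw [← hpow, ← intervalIntegral.integral_mul_const]
    refine intervalIntegral.integral_mono_on htT.le hii2 (hpowint.mul_const _) fun s hs ↦ ?_
    have h := mul_le_mul_of_nonneg_left (hmax s hs)
      (Real.rpow_nonneg (sub_nonneg.2 hs.2) (α - 1))
    calc s ^ (α - 1) * (T - s) ^ (α - 1) * e s
        = (T - s) ^ (α - 1) * (s ^ (α - 1) * e s) := by ring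
      _ ≤ _ := h
  have het : 0 < e t := hpos t ⟨ht.le, le_rfl⟩
  have hfirst' : T ^ (α - 1) / t ^ (α - 1) * ∫ s in (0 : ℝ)..t,
      s ^ (α - 1) * (t - s) ^ (α - 1) * e s = T ^ (α - 1) - Real.Gamma α * T ^ (α - 1) * e t := by
    rw [hVt]
    have : t ^ (α - 1) ≠ 0 := (Real.rpow_pos_of_pos ht _).ne'
    field_simp
    rfl
  have hstrict := mul_lt_mul_of_pos_right hclose het
  have hpos' : 0 < Real.Gamma α * (T ^ (α - 1) * e T) := by
    change _ = T ^ (α - 1) - Real.Gamma α * (T ^ (α - 1) * e T) at hVT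
    rw [← hsplit] at hVT
    linarith
  exact pos_of_mul_pos_right (pos_of_mul_pos_right hpos' hΓ.le) (by positivity)

theorem mittagLeffler2_neg_rpow_pos {α t : ℝ} (hα0 : 0 < α) (hα1 : α < 1) (ht : 0 ≤ t) :
    0 < mittagLeffler2 α α (-(t ^ α)) := by
  by_contra hneg
  set e : ℝ → ℝ := fun s ↦ mittagLeffler2 α α (-(s ^ α)) with he
  have hecont : Continuous e :=
    (continuous_mittagLeffler2 hα0 hα0).comp (Real.continuous_rpow_const hα0.le).neg
  have hΓ := Real.Gamma_pos_of_pos hα0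
  have he0 : 0 < e 0 := by
    simp only [he, Real.zero_rpow hα0.ne', neg_zero, mittagLeffler2_zero]
    positivity
  have hcomp : IsCompact (Icc 0 t ∩ e ⁻¹' Iic 0) :=
    isCompact_Icc.inter_right (isClosed_Iic.preimage hecont)
  obtain ⟨T, ⟨⟨hT0, hTt⟩, hTe⟩, hleast⟩ :=
    hcomp.exists_isLeast ⟨t, ⟨ht, le_rfl⟩, not_lt.1 hneg⟩
  have hTe' : e T ≤ 0 := hTe
  have hT : 0 < T := hT0.lt_of_ne fun h ↦ by rw [← h] at hTe'; linarith
  have hbefore (s : ℝ) (hs0 : 0 ≤ s) (hsT : s < T) : 0 < e s := by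
    by_contra h
    exact hsT.not_ge (hleast ⟨⟨hs0, hsT.le.trans hTt⟩, not_lt.1 h⟩)
  have hclose : ∀ᶠ r in 𝓝 T,
      (T - r) ^ α / α * r ^ (α - 1) < Real.Gamma α * T ^ (α - 1) := by
    have hc : ContinuousAt (fun r : ℝ ↦ (T - r) ^ α / α * r ^ (α - 1)) T := by
      refine ContinuousAt.mul (ContinuousAt.div_const ?_ _)
        (Real.continuousAt_rpow_const _ _ (Or.inl hT.ne'))
      exact ((Real.continuous_rpow_const hα0.le).comp
        (continuous_const.sub continuous_id)).continuousAt
    refine hc.eventually_lt continuousAt_const ?_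
    simp only [sub_self, Real.zero_rpow hα0.ne', zero_div, zero_mul]
    positivity
  obtain ⟨l, hlT, hl⟩ := exists_Ioc_subset_of_mem_nhds hclose ⟨0, hT⟩
  obtain ⟨p, hp, hpT⟩ := exists_between (max_lt hT hlT)
  have hp0 : 0 < p := (le_max_left _ _).trans_lt hp
  have hpl : l < p := (le_max_right _ _).trans_lt hp
  have hucont : ContinuousOn (fun s ↦ s ^ (α - 1) * e s) (Icc p T) :=
    (continuousOn_id.rpow_const fun s hs ↦ Or.inl (hp0.trans_le hs.1).ne').mul
      hecont.continuousOn
  obtain ⟨r, hr, hrmax⟩ := isCompact_Icc.exists_isMaxOn (nonempty_Icc.2 hpT.le) hucont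
  have hr0 : 0 < r := hp0.trans_le hr.1
  have hur : 0 < r ^ (α - 1) * e r :=
    (mul_pos (Real.rpow_pos_of_pos hp0 _) (hbefore p hp0.le hpT)).trans_le
      (hrmax (left_mem_Icc.2 hpT.le))
  have her : 0 < e r := pos_of_mul_pos_right hur (by positivity)
  have hrT : r < T := hr.2.lt_of_ne fun h ↦ by rw [h] at her; linarith
  exact hTe'.not_gt (mittagLeffler2_pos_of_forall_le hα0 hα1 hr0 hrT
    (fun s hs ↦ hbefore s hs.1 (hs.2.trans_lt hrT))
    (fun s hs ↦ hrmax ⟨hr.1.trans hs.1, hs.2⟩) (hl ⟨hpl.trans_le hr.1, hrT.le⟩))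

end

/-- For `0 < α < 1` and `t > 0`, `E_{α,α}(-t^α) > 0`; consequently
`-Φ_α(t) = t^(α-1) E_{α,α}(-t^α)` is strictly positive for `t > 0`. -/
theorem mittagLeffler2_pos
    (α : ℝ) (hα0 : 0 < α) (hα1 : α < 1) :
    ∀ t : ℝ, 0 < t →
      0 < mittagLeffler2 α α (-(t ^ α)) ∧
      0 < t ^ (α - 1) * mittagLeffler2 α α (-(t ^ α)) := by
  intro t ht
  have h := mittagLeffler2_neg_rpow_pos hα0 hα1 ht.le
  exact ⟨h, mul_pos (Real.rpow_pos_of_pos ht _) h⟩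
end
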